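/- Let δ ≥ 0 and let H be a δ-hyperbolic Busemann space with fixed base point w ∈ H and boundary point a ∈ ∂H. Let x, y ∈ H with h(x) ≤ h(y), let V_x be a vertical geodesic through x parametrised so that h(V_x(t)) = t, and set x' = V_x(h(y)), the point of V_x at the same height as y. Then |d_r(x,y) − d(x',y)| ≤ 54δ. -/

import Mathlib

open Set Filter
open scoped ENNReal NNReal

noncomputable section

namespace HP

variable {H : Type*} [MetricSpace H]

/-- `γ` restricted to `I` is an arclength-parametrised (isometric) geodesic. -/
def IsGeodesicOn (γ : ℝ → H) (I : Set ℝ) : Prop :=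
  ∀ s ∈ I, ∀ t ∈ I, dist (γ s) (γ t) = |s - t|

/-- A geodesic line of `H`. -/
def IsGeodesicLine (γ : ℝ → H) : Prop := IsGeodesicOn γ Set.univ

/-- A geodesic ray of `H`, parametrised on `[0,∞)`. -/
def IsGeodesicRay (γ : ℝ → H) : Prop := IsGeodesicOn γ (Set.Ici 0)

/-- A geodesic ray starting at `w`. -/
def IsRayFrom (w : H) (γ : ℝ → H) : Prop := IsGeodesicRay γ ∧ γ 0 = w

/-- A geodesic segment from `x` to `y`, parametrised on `[0, dist x y]`. -/
def IsGeodSegment (γ : ℝ → H) (x y : H) : Prop :=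
  IsGeodesicOn γ (Set.Icc 0 (dist x y)) ∧ γ 0 = x ∧ γ (dist x y) = y

/-- The traces on `[0,∞)` of two rays are at finite Hausdorff distance. -/
def FinHausRays (γ₁ γ₂ : ℝ → H) : Prop :=
  ∃ C : ℝ, (∀ s : ℝ, 0 ≤ s → ∃ t : ℝ, 0 ≤ t ∧ dist (γ₁ s) (γ₂ t) ≤ C) ∧
           (∀ t : ℝ, 0 ≤ t → ∃ s : ℝ, 0 ≤ s ∧ dist (γ₁ s) (γ₂ t) ≤ C)

/-- A geodesic metric space: any two points are joined by a geodesic segment. -/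
def GeodesicSpace (H : Type*) [MetricSpace H] : Prop :=
  ∀ x y : H, ∃ γ : ℝ → H, IsGeodSegment γ x y

/-- `δ`-hyperbolicity: geodesic space all of whose geodesic triangles are `δ`-slim,
i.e. each side is contained in the `δ`-neighbourhood of the union of the other two. -/
def DeltaHyperbolic (H : Type*) [MetricSpace H] (δ : ℝ) : Prop :=
  GeodesicSpace H ∧
  ∀ x y z : H, ∀ γ₁ γ₂ γ₃ : ℝ → H,
    IsGeodSegment γ₁ x y → IsGeodSegment γ₂ y z → IsGeodSegment γ₃ z x →
    ∀ s ∈ Set.Icc (0:ℝ) (dist x y),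
      ∃ u ∈ γ₂ '' Set.Icc (0:ℝ) (dist y z) ∪ γ₃ '' Set.Icc (0:ℝ) (dist z x),
        dist (γ₁ s) u ≤ δ

/-- A Busemann space: geodesic, and the distance between any two
arclength-parametrised geodesics is a convex function. -/
def BusemannSpace (H : Type*) [MetricSpace H] : Prop :=
  GeodesicSpace H ∧
  ∀ (a b a' b' : ℝ) (γ γ' : ℝ → H),
    IsGeodesicOn γ (Set.Icc a b) → IsGeodesicOn γ' (Set.Icc a' b') →
    ConvexOn ℝ (Set.Icc a b ×ˢ Set.Icc a' b')
      (fun p : ℝ × ℝ => dist (γ p.1) (γ' p.2))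

/-- Geodesic completeness: every geodesic segment extends to a geodesic line. -/
def GeodesicallyComplete (H : Type*) [MetricSpace H] : Prop :=
  ∀ (a b : ℝ) (γ : ℝ → H), a ≤ b → IsGeodesicOn γ (Set.Icc a b) →
    ∃ γ' : ℝ → H, IsGeodesicLine γ' ∧ ∀ t ∈ Set.Icc a b, γ' t = γ t

/-- The Busemann function with respect to the boundary point represented by the
geodesic ray `aRep` and the base point `w`. -/
def busemann (w : H) (aRep : ℝ → H) (x : H) : ℝ :=
  sSup { b : ℝ | ∃ k : ℝ → H, IsRayFrom w k ∧ FinHausRays aRep k ∧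
    b = Filter.limsup (fun t => dist x (k t) - t) Filter.atTop }

/-- The height function: minus the Busemann function. -/
def height (w : H) (aRep : ℝ → H) (x : H) : ℝ := - busemann w aRep x

/-- A vertical geodesic (forward oriented): a geodesic line whose height tends to `+∞`. -/
def IsVerticalGeodesic (w : H) (aRep : ℝ → H) (V : ℝ → H) : Prop :=
  IsGeodesicLine V ∧ Tendsto (fun t => height w aRep (V t)) atTop atTop

/-- A vertical geodesic line (either orientation): a geodesic line whose image lies
in the boundary class, i.e. whose height tends to `+∞` along one of its ends. -/
def IsVerticalGeodesicLine (w : H) (aRep : ℝ → H) (V : ℝ → H) : Prop :=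
  IsGeodesicLine V ∧
    (Tendsto (fun t => height w aRep (V t)) atTop atTop ∨
     Tendsto (fun t => height w aRep (V t)) atBot atTop)

/-- A vertical geodesic parametrised by its height: `h(V(t)) = t` for all `t`. -/
def VertParam (w : H) (aRep : ℝ → H) (V : ℝ → H) : Prop :=
  IsGeodesicLine V ∧ ∀ t : ℝ, height w aRep (V t) = t

/-- Height difference `Δh(x,y)`. -/
def dh (w : H) (aRep : ℝ → H) (x y : H) : ℝ :=
  |height w aRep x - height w aRep y|

/-- Relative distance `d_r(x,y) = d(x,y) - Δh(x,y)`. -/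
def dr (w : H) (aRep : ℝ → H) (x y : H) : ℝ := dist x y - dh w aRep x y

/-- Maximal height `h⁺` of a path along the parameter set `I`. -/
def hplusOn (w : H) (aRep : ℝ → H) (γ : ℝ → H) (I : Set ℝ) : ℝ :=
  sSup ((fun t => height w aRep (γ t)) '' I)

/-- Minimal height `h⁻` of a path along the parameter set `I`. -/
def hminusOn (w : H) (aRep : ℝ → H) (γ : ℝ → H) (I : Set ℝ) : ℝ :=
  sInf ((fun t => height w aRep (γ t)) '' I)

/-- A path parametrised by arclength: the length of the piece on `[s,t]` equals `t - s`. -/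
def ArclengthPath (V : ℝ → H) : Prop :=
  ∀ s t : ℝ, s ≤ t → eVariationOn V (Set.Icc s t) = ENNReal.ofReal (t - s)

/-- An admissible norm on `ℝ²`: a norm with `N(1,1) = 1` and `N(a,b) ≥ (a+b)/2`. -/
structure AdmNorm where
  toFun : ℝ × ℝ → ℝ
  eq_zero_iff : ∀ v : ℝ × ℝ, toFun v = 0 ↔ v = 0
  smul_eq : ∀ (c : ℝ) (v : ℝ × ℝ), toFun (c • v) = |c| * toFun v
  add_le : ∀ v w : ℝ × ℝ, toFun (v + w) ≤ toFun v + toFun w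
  one_one : toFun (1, 1) = 1
  adm : ∀ a b : ℝ, (a + b) / 2 ≤ toFun (a, b)

/-- `C` is a comparison constant `C_N` for the admissible norm `N`:
`C ≥ 1` and `N(a,b) ≤ C(a+b)/2` for all `a,b ≥ 0`. -/
def AdmNorm.BoundConst (N : AdmNorm) (C : ℝ) : Prop :=
  1 ≤ C ∧ ∀ a b : ℝ, 0 ≤ a → 0 ≤ b → N.toFun (a, b) ≤ C * (a + b) / 2

variable {Hp Hq : Type*} [MetricSpace Hp] [MetricSpace Hq]

/-- Membership in the horospherical product: `h_p(x_p) + h_q(x_q) = 0`. -/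
def inHoro (wp : Hp) (ap : ℝ → Hp) (wq : Hq) (aq : ℝ → Hq) (z : Hp × Hq) : Prop :=
  height wp ap z.1 + height wq aq z.2 = 0

/-- The `N`-length of a path in `Hp × Hq`: supremum over finite monotone
subdivisions of the sums of the `N(d_p, d_q)`-distances. -/
def lN (Nf : ℝ × ℝ → ℝ) (γ : ℝ → Hp × Hq) (s : Set ℝ) : ℝ≥0∞ :=
  ⨆ p : ℕ × { u : ℕ → ℝ // Monotone u ∧ ∀ i, u i ∈ s },
    ∑ i ∈ Finset.range p.1,
      ENNReal.ofReal (Nf (dist (γ (p.2.1 (i+1))).1 (γ (p.2.1 i)).1,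
                          dist (γ (p.2.1 (i+1))).2 (γ (p.2.1 i)).2))

/-- The `N`-path metric: infimum of `N`-lengths of connected paths staying in the
horospherical product and joining the two points. -/
def dHN (Nf : ℝ × ℝ → ℝ) (mem : Hp × Hq → Prop) (x y : Hp × Hq) : ℝ≥0∞ :=
  ⨅ (T : ℝ) (_ : 0 ≤ T) (γ : ℝ → Hp × Hq) (_ : ContinuousOn γ (Set.Icc 0 T))
    (_ : ∀ t ∈ Set.Icc (0:ℝ) T, mem (γ t)) (_ : γ 0 = x) (_ : γ T = y),
    lN Nf γ (Set.Icc 0 T)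

/-- A geodesic of the horospherical product with respect to the `N`-path metric,
parametrised (by arclength) on `I` and staying in the product. -/
def IsHNGeodesicOn (Nf : ℝ × ℝ → ℝ) (mem : Hp × Hq → Prop)
    (α : ℝ → Hp × Hq) (I : Set ℝ) : Prop :=
  (∀ t ∈ I, mem (α t)) ∧
  ∀ s ∈ I, ∀ t ∈ I, dHN Nf mem (α s) (α t) = ENNReal.ofReal |s - t|

/-- A vertical geodesic of the horospherical product, parametrised by its height. -/
def IsHNVerticalLine (Nf : ℝ × ℝ → ℝ) (mem : Hp × Hq → Prop)
    (wp : Hp) (ap : ℝ → Hp) (V : ℝ → Hp × Hq) : Prop :=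
  IsHNGeodesicOn Nf mem V Set.univ ∧ ∀ t : ℝ, height wp ap (V t).1 = t

/-- Maximal height `h⁺` of a path of the horospherical product. -/
def hplusH (wp : Hp) (ap : ℝ → Hp) (γ : ℝ → Hp × Hq) (I : Set ℝ) : ℝ :=
  sSup ((fun t => height wp ap (γ t).1) '' I)

/-- Minimal height `h⁻` of a path of the horospherical product. -/
def hminusH (wp : Hp) (ap : ℝ → Hp) (γ : ℝ → Hp × Hq) (I : Set ℝ) : ℝ :=
  sInf ((fun t => height wp ap (γ t).1) '' I)

/-- `H_p`-type path at scale `κ`: the first component stays `κ`-close to a geodesic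
of `H_p` and the second component stays `κ`-close to a vertical geodesic of `H_q`. -/
def IsHpType (wq : Hq) (aq : ℝ → Hq) (κ : ℝ) (α : ℝ → Hp × Hq) : Prop :=
  (∃ g : ℝ → Hp, IsGeodesicLine g ∧ ∀ t : ℝ, ∃ s : ℝ, dist (α t).1 (g s) ≤ κ) ∧
  (∃ v : ℝ → Hq, IsVerticalGeodesicLine wq aq v ∧ ∀ t : ℝ, ∃ s : ℝ, dist (α t).2 (v s) ≤ κ)

/-- `H_q`-type path at scale `κ`. -/
def IsHqType (wp : Hp) (ap : ℝ → Hp) (κ : ℝ) (α : ℝ → Hp × Hq) : Prop :=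
  (∃ g : ℝ → Hq, IsGeodesicLine g ∧ ∀ t : ℝ, ∃ s : ℝ, dist (α t).2 (g s) ≤ κ) ∧
  (∃ v : ℝ → Hp, IsVerticalGeodesicLine wp ap v ∧ ∀ t : ℝ, ∃ s : ℝ, dist (α t).1 (v s) ≤ κ)

/-- Finite Hausdorff distance on `[0,∞)` between two rays, for a generalized
(`ℝ≥0∞`-valued) distance `dd`. -/
def HNFinHaus {X : Type*} (dd : X → X → ℝ≥0∞) (α β : ℝ → X) : Prop :=
  ∃ C : ℝ, (∀ s : ℝ, 0 ≤ s → ∃ t : ℝ, 0 ≤ t ∧ dd (α s) (β t) ≤ ENNReal.ofReal C) ∧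
           (∀ t : ℝ, 0 ≤ t → ∃ s : ℝ, 0 ≤ s ∧ dd (α s) (β t) ≤ ENNReal.ofReal C)

theorem finHaus_equivalence (H : Type*) [MetricSpace H] :
    Equivalence (fun γ₁ γ₂ : {γ : ℝ → H // IsGeodesicRay γ} => FinHausRays γ₁.1 γ₂.1) := by
  constructor
  · intro γ
    exact ⟨0, fun s hs => ⟨s, hs, by simp⟩, fun t ht => ⟨t, ht, by simp⟩⟩
  · rintro γ₁ γ₂ ⟨C, h1, h2⟩
    refine ⟨C, fun s hs => ?_, fun t ht => ?_⟩
    · obtain ⟨u, hu, hd⟩ := h2 s hs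
      exact ⟨u, hu, by rwa [dist_comm]⟩
    · obtain ⟨u, hu, hd⟩ := h1 t ht
      exact ⟨u, hu, by rwa [dist_comm]⟩
  · rintro γ₁ γ₂ γ₃ ⟨C, h1, h2⟩ ⟨D, g1, g2⟩
    refine ⟨C + D, fun s hs => ?_, fun t ht => ?_⟩
    · obtain ⟨u, hu, hd⟩ := h1 s hs
      obtain ⟨v, hv, he⟩ := g1 u hu
      exact ⟨v, hv, (dist_triangle _ (γ₂.1 u) _).trans (add_le_add hd he)⟩
    · obtain ⟨u, hu, hd⟩ := g2 t ht
      obtain ⟨v, hv, he⟩ := h2 u hu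
      exact ⟨v, hv, (dist_triangle _ (γ₂.1 u) _).trans (add_le_add he hd)⟩

/-- The setoid of geodesic rays up to finite Hausdorff distance. -/
instance raySetoid (H : Type*) [MetricSpace H] : Setoid {γ : ℝ → H // IsGeodesicRay γ} :=
  ⟨fun γ₁ γ₂ => FinHausRays γ₁.1 γ₂.1, finHaus_equivalence H⟩

/-- The Gromov boundary: equivalence classes of geodesic rays at finite
Hausdorff distance. -/
abbrev Bdry (H : Type*) [MetricSpace H] := Quotient (raySetoid H)

/-- The boundary point determined by a geodesic ray. -/
def bdryPt {H : Type*} [MetricSpace H] (γ : ℝ → H) (h : IsGeodesicRay γ) : Bdry H :=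
  Quotient.mk (raySetoid H) ⟨γ, h⟩

/-- The set `((∂H_p ∖ {a_p}) × {a_q}) ∪ ({a_p} × (∂H_q ∖ {a_q}))`. -/
def bdryTarget {Hp Hq : Type*} [MetricSpace Hp] [MetricSpace Hq]
    (ap : ℝ → Hp) (hap : IsGeodesicRay ap)
    (aq : ℝ → Hq) (haq : IsGeodesicRay aq) : Set (Bdry Hp × Bdry Hq) :=
  ((({bdryPt ap hap} : Set (Bdry Hp))ᶜ ×ˢ ({bdryPt aq haq} : Set (Bdry Hq))) ∪
   (({bdryPt ap hap} : Set (Bdry Hp)) ×ˢ ({bdryPt aq haq} : Set (Bdry Hq))ᶜ))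

/-- A point on a geodesic segment realises equality in the triangle inequality. -/
lemma IsGeodSegment.dist_add_dist {γ : ℝ → H} {x y u : H} (h : IsGeodSegment γ x y)
    (hu : u ∈ γ '' Set.Icc 0 (dist x y)) : dist x u + dist u y = dist x y := by
  obtain ⟨hγ, h0, h1⟩ := h
  obtain ⟨s, hs, rfl⟩ := hu
  have e0 := hγ 0 ⟨le_rfl, dist_nonneg⟩ s hs
  have e1 := hγ s hs (dist x y) ⟨dist_nonneg, le_rfl⟩
  rw [h0, zero_sub, abs_neg, abs_of_nonneg hs.1] at e0
  rw [h1, abs_of_nonpos (by linarith [hs.2])] at e1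
  linarith

lemma IsGeodesicOn.continuousOn {γ : ℝ → H} {I : Set ℝ} (h : IsGeodesicOn γ I) :
    ContinuousOn γ I := by
  refine LipschitzOnWith.continuousOn (K := 1) (LipschitzOnWith.of_dist_le_mul ?_)
  intro s hs t ht
  rw [h s hs t ht, Real.dist_eq, NNReal.coe_one, one_mul]

lemma IsGeodSegment.left_mem {γ : ℝ → H} {x y : H} (h : IsGeodSegment γ x y) :
    x ∈ γ '' Set.Icc 0 (dist x y) := ⟨0, ⟨le_rfl, dist_nonneg⟩, h.2.1⟩

lemma IsGeodSegment.right_mem {γ : ℝ → H} {x y : H} (h : IsGeodSegment γ x y) :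
    y ∈ γ '' Set.Icc 0 (dist x y) := ⟨dist x y, ⟨dist_nonneg, le_rfl⟩, h.2.2⟩

lemma IsGeodSegment.isCompact {γ : ℝ → H} {x y : H} (h : IsGeodSegment γ x y) :
    IsCompact (γ '' Set.Icc 0 (dist x y)) :=
  isCompact_Icc.image_of_continuousOn h.1.continuousOn

/-- A point within `δ` of a geodesic segment has a `δ`-close point on the segment. -/
lemma IsGeodSegment.exists_dist_le {γ : ℝ → H} {x y z : H} {δ : ℝ} (h : IsGeodSegment γ x y)
    (hz : Metric.infDist z (γ '' Set.Icc 0 (dist x y)) ≤ δ) :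
    ∃ u ∈ γ '' Set.Icc 0 (dist x y), dist z u ≤ δ := by
  obtain ⟨u, hu, e⟩ := h.isCompact.exists_infDist_eq_dist ⟨_, h.left_mem⟩ z
  exact ⟨u, hu, e ▸ hz⟩

/-- The four-point inequality in a space with slim triangles. -/
lemma DeltaHyperbolic.four_point {δ : ℝ} (hδ : 0 ≤ δ) (hH : DeltaHyperbolic H δ) (p q r s : H) :
    dist p r + dist q s ≤
      max (dist p q + dist r s) (dist q r + dist p s) + 4 * δ := by
  obtain ⟨hG, hslim⟩ := hH
  obtain ⟨g, hg⟩ := hG p r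
  obtain ⟨rq, hrq⟩ := hG r q
  obtain ⟨qp, hqp⟩ := hG q p
  obtain ⟨rs, hrs⟩ := hG r s
  obtain ⟨sp, hsp⟩ := hG s p
  have near_of_mem : ∀ {z u : H} {S : Set H}, u ∈ S → dist z u ≤ δ → Metric.infDist z S ≤ δ :=
    fun hu hd => (Metric.infDist_le_dist_of_mem hu).trans hd
  have hcover : ∀ z ∈ g '' Set.Icc 0 (dist p r), ∀ (o : H) (γ₂ γ₃ : ℝ → H),
      IsGeodSegment γ₂ r o → IsGeodSegment γ₃ o p →
      Metric.infDist z (γ₂ '' Set.Icc 0 (dist r o)) ≤ δ ∨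
      Metric.infDist z (γ₃ '' Set.Icc 0 (dist o p)) ≤ δ := by
    rintro z ⟨t, ht, rfl⟩ o γ₂ γ₃ h₂ h₃
    obtain ⟨u, hu | hu, hd⟩ := hslim p r o g γ₂ γ₃ hg h₂ h₃ t ht
    · exact Or.inl (near_of_mem hu hd)
    · exact Or.inr (near_of_mem hu hd)
  have hclosed : ∀ S : Set H, IsClosed {z | Metric.infDist z S ≤ δ} := fun S =>
    isClosed_le (Metric.continuous_infDist_pt S) continuous_const
  have hconn : IsPreconnected (g '' Set.Icc 0 (dist p r)) :=
    isPreconnected_Icc.image _ hg.1.continuousOn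
  obtain ⟨m, hm, hm₁, hm₂⟩ := isPreconnected_closed_iff.1 hconn _ _
    (hclosed (rq '' Set.Icc 0 (dist r q))) (hclosed (qp '' Set.Icc 0 (dist q p)))
    (fun z hz => hcover z hz q rq qp hrq hqp)
    ⟨r, hg.right_mem, near_of_mem hrq.left_mem (by simpa using hδ)⟩
    ⟨p, hg.left_mem, near_of_mem hqp.right_mem (by simpa using hδ)⟩
  have em := hg.dist_add_dist hm
  rcases hcover m hm s rs sp hrs hsp with hm₃ | hm₃
  · obtain ⟨u, hu, hmu⟩ := hqp.exists_dist_le hm₂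
    obtain ⟨v, hv, hmv⟩ := hrs.exists_dist_le hm₃
    have eu := hqp.dist_add_dist hu
    have ev := hrs.dist_add_dist hv
    have := le_max_left (dist p q + dist r s) (dist q r + dist p s)
    have := dist_triangle p u m
    have := dist_triangle m v r
    have := dist_triangle4 q u v s
    have := dist_triangle u m v
    rw [dist_comm] at hmu
    linarith [dist_comm u p, dist_comm r v, dist_comm p q]
  · obtain ⟨u, hu, hmu⟩ := hrq.exists_dist_le hm₁
    obtain ⟨v, hv, hmv⟩ := hsp.exists_dist_le hm₃
    have eu := hrq.dist_add_dist hu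
    have ev := hsp.dist_add_dist hv
    have := le_max_right (dist p q + dist r s) (dist q r + dist p s)
    have := dist_triangle p v m
    have := dist_triangle m u r
    have := dist_triangle4 q u v s
    have := dist_triangle u m v
    linarith [dist_comm r u, dist_comm u m, dist_comm u q, dist_comm v p, dist_comm m v,
      dist_comm s v, dist_comm r q, dist_comm s p]

/-- In a Busemann space, asymptotic rays with the same origin agree. -/
lemma BusemannSpace.ray_unique (hB : BusemannSpace H) {w : H} {a k : ℝ → H}
    (ha : IsRayFrom w a) (hk : IsRayFrom w k) (hak : FinHausRays a k) {s : ℝ} (hs : 0 ≤ s) :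
    k s = a s := by
  obtain ⟨C, hC, -⟩ := hak
  have hbound : ∀ T : ℝ, 0 ≤ T → dist (a T) (k T) ≤ 2 * C := by
    intro T hT
    obtain ⟨t, ht, hd⟩ := hC T hT
    have e₁ := ha.1 0 self_mem_Ici T hT
    have e₂ := hk.1 0 self_mem_Ici t ht
    have e₃ := hk.1 t ht T hT
    rw [ha.2, zero_sub, abs_neg, abs_of_nonneg hT] at e₁
    rw [hk.2, zero_sub, abs_neg, abs_of_nonneg ht] at e₂
    have : |t - T| ≤ C := by
      rw [abs_le]
      constructor
      · linarith [dist_triangle w (k t) (a T), dist_comm (k t) (a T)]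
      · linarith [dist_triangle w (a T) (k t)]
    linarith [dist_triangle (a T) (k t) (k T)]
  have hconv : ∀ T : ℝ, 0 < T → s ≤ T → dist (a s) (k s) ≤ s / T * (2 * C) := by
    intro T hT hsT
    have hsub : Set.Icc 0 T ⊆ Set.Ici 0 := Set.Icc_subset_Ici_self
    have hc := (hB.2 0 T 0 T a k (fun u hu v hv => ha.1 u (hsub hu) v (hsub hv))
      (fun u hu v hv => hk.1 u (hsub hu) v (hsub hv))).2
    have h0 : (0 : ℝ) ∈ Set.Icc 0 T := ⟨le_rfl, hT.le⟩
    have h1 : T ∈ Set.Icc 0 T := ⟨hT.le, le_rfl⟩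
    have h := hc (x := (0, 0)) ⟨h0, h0⟩ (y := (T, T)) ⟨h1, h1⟩ (a := 1 - s / T) (b := s / T)
      (sub_nonneg.2 ((div_le_one hT).2 hsT)) (div_nonneg hs hT.le) (by ring)
    simp only [Prod.smul_mk, Prod.mk_add_mk, smul_eq_mul, mul_zero, zero_add,
      div_mul_cancel₀ s hT.ne', ha.2, hk.2, dist_self] at h
    exact h.trans (mul_le_mul_of_nonneg_left (hbound T hT.le) (div_nonneg hs hT.le))
  have hlim : Tendsto (fun T : ℝ => s / T * (2 * C)) atTop (nhds 0) := by
    simpa using (tendsto_const_nhds (x := s)).div_atTop tendsto_id |>.mul_const (2 * C)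
  have hle : dist (a s) (k s) ≤ 0 := by
    refine ge_of_tendsto hlim ?_
    filter_upwards [eventually_gt_atTop 0, eventually_ge_atTop s] with T hT hsT
    exact hconv T hT hsT
  exact (dist_le_zero.1 hle).symm

/-- Along a ray, `d(x, a(t)) - t` converges. -/
lemma IsRayFrom.exists_tendsto {w : H} {a : ℝ → H} (ha : IsRayFrom w a) (x : H) :
    ∃ l : ℝ, Tendsto (fun t => dist x (a t) - t) atTop (nhds l) := by
  have hanti : Antitone fun t : ℝ => dist x (a (max t 0)) - max t 0 := by
    intro s t hst
    have hm : max s 0 ≤ max t 0 := max_le_max_right 0 hst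
    have e := ha.1 (max s 0) (Set.mem_Ici.2 (le_max_right _ _)) (max t 0) (Set.mem_Ici.2 (le_max_right _ _))
    rw [abs_of_nonpos (sub_nonpos.2 hm)] at e
    linarith [dist_triangle x (a (max s 0)) (a (max t 0))]
  have hbdd : BddBelow (Set.range fun t : ℝ => dist x (a (max t 0)) - max t 0) := by
    refine ⟨-dist x w, ?_⟩
    rintro _ ⟨t, rfl⟩
    have e := ha.1 0 self_mem_Ici (max t 0) (Set.mem_Ici.2 (le_max_right _ _))
    rw [ha.2, zero_sub, abs_neg, abs_of_nonneg (le_max_right _ _)] at e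
    linarith [dist_triangle w x (a (max t 0)), dist_comm w x]
  refine ⟨_, (tendsto_atTop_ciInf hanti hbdd).congr' ?_⟩
  filter_upwards [eventually_ge_atTop 0] with t ht
  rw [max_eq_left ht]

/-- In a Busemann space, the Busemann function is a limit along the given ray. -/
lemma BusemannSpace.tendsto_height (hB : BusemannSpace H) {w : H} {a : ℝ → H}
    (ha : IsRayFrom w a) (x : H) :
    Tendsto (fun t => dist x (a t) - t) atTop (nhds (-height w a x)) := by
  obtain ⟨l, hl⟩ := ha.exists_tendsto x
  have hset : { b : ℝ | ∃ k : ℝ → H, IsRayFrom w k ∧ FinHausRays a k ∧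
      b = Filter.limsup (fun t => dist x (k t) - t) Filter.atTop } = {l} := by
    ext b
    rw [Set.mem_singleton_iff]
    constructor
    · rintro ⟨k, hk, hak, rfl⟩
      refine Tendsto.limsup_eq (hl.congr' ?_)
      filter_upwards [eventually_ge_atTop 0] with t ht
      rw [hB.ray_unique ha hk hak ht]
    · rintro rfl
      exact ⟨a, ha, ⟨0, fun s hs => ⟨s, hs, by simp⟩, fun t ht => ⟨t, ht, by simp⟩⟩,
        hl.limsup_eq.symm⟩
  rwa [height, neg_neg, busemann, hset, csSup_singleton]

lemma BusemannSpace.height_sub_le_dist (hB : BusemannSpace H) {w : H} {a : ℝ → H}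
    (ha : IsRayFrom w a) (x y : H) : height w a y - height w a x ≤ dist x y := by
  have h := (hB.tendsto_height ha x).sub (hB.tendsto_height ha y)
  have := le_of_tendsto' h (b := dist x y) fun t => by linarith [dist_triangle x y (a t)]
  linarith

/-- The four-point inequality with one point sent to the boundary point `a`. -/
lemma four_point_height {δ : ℝ} (hδ : 0 ≤ δ) (hH : DeltaHyperbolic H δ) (hB : BusemannSpace H)
    {w : H} {a : ℝ → H} (ha : IsRayFrom w a) (p q r : H) :
    dist p r - height w a q ≤
      max (dist p q - height w a r) (dist q r - height w a p) + 4 * δ := by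
  refine le_of_tendsto_of_tendsto' ((hB.tendsto_height ha q).const_add (dist p r))
    ((((hB.tendsto_height ha r).const_add (dist p q)).max
      ((hB.tendsto_height ha p).const_add (dist q r))).add_const (4 * δ)) fun t => ?_
  have h := hH.four_point hδ p q r (a t)
  rw [← add_sub_assoc, ← add_sub_assoc, ← add_sub_assoc, max_sub_sub_right]
  linarith

/-- If `h(x) ≤ h(y)` and `x'` is the point of the vertical geodesic
through `x` at the height of `y`, then `|d_r(x,y) - d(x',y)| ≤ 54δ`. -/
theorem statement4 {H : Type*} [MetricSpace H]
    (δ : ℝ) (hδ : 0 ≤ δ) (hH : DeltaHyperbolic H δ) (hB : BusemannSpace H)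
    (w : H) (a : ℝ → H) (ha : IsRayFrom w a)
    (x y : H) (hxy : height w a x ≤ height w a y)
    (Vx : ℝ → H) (hVx : VertParam w a Vx) (hVxx : Vx (height w a x) = x) :
    |dr w a x y - dist (Vx (height w a y)) y| ≤ 54 * δ := by
  have hd : dist (Vx (height w a y)) x = height w a y - height w a x := by
    have h := hVx.1 (height w a y) (Set.mem_univ _) (height w a x) (Set.mem_univ _)
    rwa [hVxx, abs_of_nonneg (sub_nonneg.2 hxy)] at h
  have hfour := four_point_height hδ hH hB ha (Vx (height w a y)) x y
  rw [hVx.2] at hfour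
  have hlip := hB.height_sub_le_dist ha x y
  have htri := dist_triangle x (Vx (height w a y)) y
  rw [dist_comm x (Vx _)] at htri
  have hmax : max (dist (Vx (height w a y)) x - height w a y) (dist x y - height w a y) =
      dist x y - height w a y := max_eq_right (by linarith)
  rw [hmax] at hfour
  rw [dr, dh, abs_of_nonpos (sub_nonpos.2 hxy), abs_le]
  constructor <;> linarith

end HP

end
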